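/- arXiv:1911.03618 — 3 statements merged into one kernel-verified Lean document; each statement's English description precedes it below -/
import Mathlib

section
/- Let (Ω, P) be a probability space, let ι be a finite nonempty type, let S' : Ω → ι be a measurable random variable (the next state), and let R' : Ω → ℝ be a random variable (the future return from the next state) such that R'^2 is integrable. For each i ∈ ι set p(i) = P(S' = i), and assume p(i) > 0 for every i. Define the conditional mean Q(i) = (∫_{S'=i} R' dP) / p(i) and the conditional variance Υ(i) = (∫_{S'=i} R'^2 dP) / p(i) − Q(i)^2. Then for any real constants r (the immediate reward) and γ (the discount factor), the variance of the one-step return r + γ·R' satisfies the distributional Bellman projection equation: E[(r + γR')^2] − (E[r + γR'])^2 = r^2 + 2γ·r·Σ_{i} p(i)·Q(i) + γ^2·Σ_{i} p(i)·Υ(i) + γ^2·Σ_{i} p(i)·Q(i)^2 − (r + γ·Σ_{i} p(i)·Q(i))^2. -/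
open MeasureTheory

theorem integral_eq_sum_setIntegral_preimage_singleton
    {Ω ι E : Type*} [MeasurableSpace Ω] [Fintype ι] [MeasurableSpace ι]
    [MeasurableSingletonClass ι] [NormedAddCommGroup E] [NormedSpace ℝ E]
    {μ : Measure Ω} {S : Ω → ι} (hS : Measurable S) {f : Ω → E} (hf : Integrable f μ) :
    ∫ ω, f ω ∂μ = ∑ i, ∫ ω in S ⁻¹' {i}, f ω ∂μ := by
  rw [← integral_iUnion_fintype (fun i => hS (measurableSet_singleton i))
    (pairwise_disjoint_fiber S) (fun _ => hf.integrableOn), ← Set.preimage_iUnion,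
    Set.iUnion_of_singleton, Set.preimage_univ, Measure.restrict_univ]

/-- Proposition 1: distributional Bellman projection equation for the variance of the
one-step return `r + γ·R'`, where the next state `S'` takes finitely many values. -/
theorem variance_bellman_projection
    {Ω : Type*} [MeasurableSpace Ω] (P : Measure Ω) [IsProbabilityMeasure P]
    {ι : Type*} [Fintype ι] [Nonempty ι] [MeasurableSpace ι] [MeasurableSingletonClass ι]
    (S' : Ω → ι) (hS' : Measurable S')
    (R' : Ω → ℝ) (hR' : Measurable R')
    (hR'2 : Integrable (fun ω => (R' ω) ^ 2) P)
    (p : ι → ℝ) (hp : ∀ i, p i = (P (S' ⁻¹' {i})).toReal)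
    (hppos : ∀ i, 0 < p i)
    (Q : ι → ℝ) (hQ : ∀ i, Q i = (∫ ω in S' ⁻¹' {i}, R' ω ∂P) / p i)
    (Υ : ι → ℝ) (hΥ : ∀ i, Υ i = (∫ ω in S' ⁻¹' {i}, (R' ω) ^ 2 ∂P) / p i - (Q i) ^ 2)
    (r γ : ℝ) :
    (∫ ω, (r + γ * R' ω) ^ 2 ∂P) - (∫ ω, (r + γ * R' ω) ∂P) ^ 2
      = r ^ 2 + 2 * γ * r * ∑ i, p i * Q i + γ ^ 2 * ∑ i, p i * Υ i
        + γ ^ 2 * ∑ i, p i * (Q i) ^ 2 - (r + γ * ∑ i, p i * Q i) ^ 2 := by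
  have hint : Integrable R' P :=
    ((memLp_two_iff_integrable_sq hR'.aestronglyMeasurable).2 hR'2).integrable one_le_two
  have hmean : ∑ i, p i * Q i = ∫ ω, R' ω ∂P := by
    rw [integral_eq_sum_setIntegral_preimage_singleton hS' hint]
    refine Finset.sum_congr rfl fun i _ => ?_
    rw [hQ, mul_div_cancel₀ _ (hppos i).ne']
  have hsecond : ∑ i, p i * Υ i + ∑ i, p i * (Q i) ^ 2 = ∫ ω, (R' ω) ^ 2 ∂P := by
    rw [integral_eq_sum_setIntegral_preimage_singleton hS' hR'2, ← Finset.sum_add_distrib]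
    refine Finset.sum_congr rfl fun i _ => ?_
    rw [← mul_add, hΥ, sub_add_cancel, mul_div_cancel₀ _ (hppos i).ne']
  have hfirst : ∫ ω, (r + γ * R' ω) ∂P = r + γ * ∫ ω, R' ω ∂P := by
    rw [integral_add (integrable_const r) (hint.const_mul γ), integral_const_mul]
    simp
  have hsq : ∫ ω, (r + γ * R' ω) ^ 2 ∂P
      = r ^ 2 + 2 * γ * r * ∫ ω, R' ω ∂P + γ ^ 2 * ∫ ω, (R' ω) ^ 2 ∂P := by
    have hexpand : ∀ ω, (r + γ * R' ω) ^ 2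
        = (r ^ 2 + 2 * γ * r * R' ω) + γ ^ 2 * (R' ω) ^ 2 := fun ω => by ring
    simp_rw [hexpand]
    have hlin : Integrable (fun ω => r ^ 2 + 2 * γ * r * R' ω) P :=
      (integrable_const _).add (hint.const_mul _)
    rw [integral_add hlin (hR'2.const_mul _),
      integral_add (integrable_const _) (hint.const_mul _), integral_const_mul,
      integral_const_mul]
    simp
  rw [hsq, hfirst, hmean, ← hsecond]
  ring
end

section
/- Let S and A be finite nonempty types (state and action spaces), let P : S → A → S → ℝ be a transition kernel with P(s,a,s') ≥ 0 and Σ_{s'} P(s,a,s') = 1 for all (s,a), let r : S → A → ℝ be a reward function, let γ ∈ [0,1) be a discount factor, and fix an initial state s₀ ∈ S. Let π : ℝ → S → A → ℝ be a parameterized stochastic policy such that for every parameter θ ∈ ℝ and state s, π(θ,s,·) is a probability vector (nonnegative, summing to 1 over actions), and for every (s,a) the map θ ↦ π(θ,s,a) is differentiable. Let Γ : ℝ → S → A → ℝ be such that for every (s,a) the map θ ↦ Γ(θ,s,a) is differentiable, and for every θ the Bellman equation Γ(θ,s,a) = r(s,a) + γ·Σ_{s'} P(s,a,s')·Σ_{a'}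 π(θ,s',a')·Γ(θ,s',a') holds for all (s,a). Define the state-transition matrix M(θ) by M(θ)(s,s') = Σ_a π(θ,s,a)·P(s,a,s'), the discounted occupancy ρ(θ,s) = Σ_{t=0}^∞ γ^t·(M(θ)^t)(s₀,s) (a convergent series), and the objective J(θ) = Σ_a π(θ,s₀,a)·Γ(θ,s₀,a). Then for every θ, the derivative of J satisfies the policy gradient identity: J'(θ) = Σ_{s ∈ S} ρ(θ,s)·Σ_{a ∈ A} (∂/∂θ π(θ,s,a))·Γ(θ,s,a). -/
open scoped BigOperators

/-- Powers of a row-stochastic matrix are summable against geometric weights. -/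
theorem summable_geometric_mul_rowStochastic_pow {S : Type*} [Fintype S] [DecidableEq S]
    {M : Matrix S S ℝ} (hM : M ∈ Matrix.rowStochastic ℝ S) {γ : ℝ} (hγ0 : 0 ≤ γ) (hγ1 : γ < 1)
    (i j : S) : Summable fun t : ℕ => γ ^ t * (M ^ t) i j := by
  refine .of_nonneg_of_le (fun t => ?_) (fun t => ?_) (summable_geometric_of_lt_one hγ0 hγ1)
  · exact mul_nonneg (pow_nonneg hγ0 t) (Matrix.nonneg_of_mem_rowStochastic (pow_mem hM t))
  · exact mul_le_of_le_one_right (pow_nonneg hγ0 t)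
      (Matrix.le_one_of_mem_rowStochastic (pow_mem hM t))

/-- The discounted occupancy of a row-stochastic matrix satisfies the flow equation. -/
theorem tsum_geometric_mul_rowStochastic_pow {S : Type*} [Fintype S] [DecidableEq S]
    {M : Matrix S S ℝ} (hM : M ∈ Matrix.rowStochastic ℝ S) {γ : ℝ} (hγ0 : 0 ≤ γ) (hγ1 : γ < 1)
    (i j : S) :
    ∑' t : ℕ, γ ^ t * (M ^ t) i j =
      (if i = j then 1 else 0) + γ * ∑ k, (∑' t : ℕ, γ ^ t * (M ^ t) i k) * M k j := by
  have hs := summable_geometric_mul_rowStochastic_pow hM hγ0 hγ1 i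
  rw [(hs j).tsum_eq_zero_add]
  congr 1
  · simp [Matrix.one_apply]
  · simp_rw [← tsum_mul_right]
    rw [← Summable.tsum_finsetSum fun k _ => (hs k).mul_right _, ← tsum_mul_left]
    refine tsum_congr fun t => ?_
    rw [pow_succ M, Matrix.mul_apply, Finset.mul_sum, Finset.mul_sum]
    exact Finset.sum_congr rfl fun k _ => by ring

/-- A solution of the linear equation `x = b + γ M x` is `b` integrated against the discounted
occupancy of `M`. -/
theorem eq_sum_tsum_geometric_mul_of_eq_add {S : Type*} [Fintype S] [DecidableEq S]
    {M : Matrix S S ℝ} (hM : M ∈ Matrix.rowStochastic ℝ S) {γ : ℝ} (hγ0 : 0 ≤ γ) (hγ1 : γ < 1)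
    {x b : S → ℝ} (hx : ∀ s, x s = b s + γ * ∑ s', M s s' * x s') (i : S) :
    x i = ∑ s, (∑' t : ℕ, γ ^ t * (M ^ t) i s) * b s := by
  have hflow := tsum_geometric_mul_rowStochastic_pow hM hγ0 hγ1 i
  set R : S → ℝ := fun s => ∑' t : ℕ, γ ^ t * (M ^ t) i s
  change ∀ j, R j = (if i = j then 1 else 0) + γ * ∑ k, R k * M k j at hflow
  change x i = ∑ s, R s * b s
  have h₁ : ∑ s, R s * x s = x i + γ * ∑ s, ∑ k, R k * M k s * x s := by
    calc ∑ s, R s * x s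
        = ∑ s, ((if i = s then 1 else 0) + γ * ∑ k, R k * M k s) * x s :=
          Finset.sum_congr rfl fun s _ => by rw [← hflow s]
      _ = x i + γ * ∑ s, ∑ k, R k * M k s * x s := by
          simp [add_mul, Finset.sum_add_distrib, Finset.mul_sum, Finset.sum_mul, mul_assoc]
  have h₂ : ∑ s, R s * x s = ∑ s, R s * b s + γ * ∑ k, ∑ s, R k * M k s * x s := by
    calc ∑ s, R s * x s = ∑ s, R s * (b s + γ * ∑ s', M s s' * x s') :=
          Finset.sum_congr rfl fun s _ => by rw [← hx s]
      _ = ∑ s, R s * b s + γ * ∑ k, ∑ s, R k * M k s * x s := by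
          simp only [mul_add, Finset.sum_add_distrib, Finset.mul_sum, mul_assoc, mul_left_comm γ]
  rw [Finset.sum_comm] at h₂
  linarith

/-- Theorem 2 (CVaR policy gradient theorem) for a finite MDP with a scalar policy
parameter: the derivative of the start-state objective `J(θ) = ∑ a, π(θ,s₀,a)·Γ(θ,s₀,a)`
equals `∑ s, ρ(θ,s) · ∑ a, ∂θ π(θ,s,a) · Γ(θ,s,a)`, where `ρ` is the γ-discounted
state occupancy from `s₀`. -/
theorem cvar_policy_gradient
    {S A : Type*} [Fintype S] [DecidableEq S] [Nonempty S] [Fintype A] [Nonempty A]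
    (P : S → A → S → ℝ) (hP0 : ∀ s a s', 0 ≤ P s a s') (hP1 : ∀ s a, ∑ s', P s a s' = 1)
    (r : S → A → ℝ) (γ : ℝ) (hγ0 : 0 ≤ γ) (hγ1 : γ < 1) (s₀ : S)
    (π : ℝ → S → A → ℝ)
    (hπ0 : ∀ θ s a, 0 ≤ π θ s a) (hπ1 : ∀ θ s, ∑ a, π θ s a = 1)
    (hπd : ∀ s a, Differentiable ℝ (fun θ => π θ s a))
    (Γ : ℝ → S → A → ℝ)
    (hΓd : ∀ s a, Differentiable ℝ (fun θ => Γ θ s a))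
    (hBell : ∀ θ s a,
      Γ θ s a = r s a + γ * ∑ s', P s a s' * ∑ a', π θ s' a' * Γ θ s' a')
    (M : ℝ → Matrix S S ℝ) (hM : ∀ θ s s', M θ s s' = ∑ a, π θ s a * P s a s')
    (ρ : ℝ → S → ℝ) (hρ : ∀ θ s, ρ θ s = ∑' t : ℕ, γ ^ t * ((M θ) ^ t) s₀ s)
    (J : ℝ → ℝ) (hJ : ∀ θ, J θ = ∑ a, π θ s₀ a * Γ θ s₀ a) :
    ∀ θ, deriv J θ = ∑ s, ρ θ s * ∑ a, deriv (fun θ' => π θ' s a) θ * Γ θ s a := by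
  intro θ
  have hMs : M θ ∈ Matrix.rowStochastic ℝ S := by
    rw [Matrix.mem_rowStochastic_iff_sum]
    refine ⟨fun s s' => ?_, fun s => ?_⟩
    · rw [hM]
      exact Finset.sum_nonneg fun a _ => mul_nonneg (hπ0 θ s a) (hP0 s a s')
    · simp_rw [hM]
      rw [Finset.sum_comm]
      simp_rw [← Finset.mul_sum, hP1, mul_one, hπ1]
  have hV : ∀ s, HasDerivAt (fun θ' => ∑ a, π θ' s a * Γ θ' s a)
      (∑ a, (deriv (fun θ' => π θ' s a) θ * Γ θ s a + π θ s a * deriv (fun θ' => Γ θ' s a) θ)) θ :=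
    fun s => HasDerivAt.fun_sum fun a _ => (hπd s a θ).hasDerivAt.mul (hΓd s a θ).hasDerivAt
  have hΓ : ∀ s a, deriv (fun θ' => Γ θ' s a) θ =
      γ * ∑ s', P s a s' * deriv (fun θ' => ∑ a', π θ' s' a' * Γ θ' s' a') θ := by
    intro s a
    have h := ((HasDerivAt.fun_sum (u := Finset.univ) fun s' _ =>
      ((hV s').differentiableAt.hasDerivAt.const_mul (P s a s'))).const_mul γ).const_add (r s a)
    rw [← h.deriv]
    exact congrArg (deriv · θ) (funext fun θ' => hBell θ' s a)
  have hlin : ∀ s, deriv (fun θ' => ∑ a, π θ' s a * Γ θ' s a) θ =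
      ∑ a, deriv (fun θ' => π θ' s a) θ * Γ θ s a +
        γ * ∑ s', M θ s s' * deriv (fun θ' => ∑ a, π θ' s' a * Γ θ' s' a) θ := by
    intro s
    rw [(hV s).deriv, Finset.sum_add_distrib]
    congr 1
    simp_rw [hΓ, hM, Finset.sum_mul, Finset.mul_sum]
    rw [Finset.sum_comm]
    exact Finset.sum_congr rfl fun s' _ => Finset.sum_congr rfl fun a _ => by ring
  rw [funext hJ, eq_sum_tsum_geometric_mul_of_eq_add hMs hγ0 hγ1 hlin s₀]
  simp_rw [hρ]
end

section
/- Let Φ denote the cumulative distribution function of the standard Gaussian measure on ℝ (mean 0, variance 1), and let g : ℝ → ℝ be a standard normal quantile function, i.e. Φ(g(s)) = s for every s ∈ (0,1). Let μ₁, μ₂ ∈ ℝ and σ₁, σ₂ ≥ 0. Then the function s ↦ ((μ₁ + σ₁·g(s)) − (μ₂ + σ₂·g(s)))² is integrable on (0,1) and ∫_{(0,1)} ((μ₁ + σ₁·g(s)) − (μ₂ + σ₂·g(s)))² ds = (μ₁ − μ₂)² + (σ₁ − σ₂)². -/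
open MeasureTheory

open ProbabilityTheory in
/-- A right inverse on `(0, 1)` of the distribution function is monotone there. -/
lemma monotoneOn_of_cdf_rightInverse {μ : Measure ℝ} {g : ℝ → ℝ}
    (hg : ∀ s ∈ Set.Ioo (0 : ℝ) 1, cdf μ (g s) = s) : MonotoneOn g (Set.Ioo 0 1) := by
  intro s hs t ht hst
  by_contra! h
  have h' := monotone_cdf μ h.le
  rw [hg s hs, hg t ht] at h'
  obtain rfl := le_antisymm hst h'
  exact lt_irrefl _ h

open ProbabilityTheory in
/-- Inverse transform sampling: a right inverse on `(0, 1)` of the distribution function of `μ`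
pushes the uniform measure on `(0, 1)` forward to `μ`. -/
lemma map_restrict_Ioo_of_cdf_rightInverse {μ : Measure ℝ} [IsProbabilityMeasure μ] {g : ℝ → ℝ}
    (hg : ∀ s ∈ Set.Ioo (0 : ℝ) 1, cdf μ (g s) = s) :
    (volume.restrict (Set.Ioo (0 : ℝ) 1)).map g = μ := by
  have hgm : AEMeasurable g (volume.restrict (Set.Ioo (0 : ℝ) 1)) :=
    aemeasurable_restrict_of_monotoneOn measurableSet_Ioo (monotoneOn_of_cdf_rightInverse hg)
  have : IsProbabilityMeasure (volume.restrict (Set.Ioo (0 : ℝ) 1)) := ⟨by simp⟩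
  have := Measure.isProbabilityMeasure_map hgm
  refine Measure.ext_of_Iic _ _ fun x => ?_
  rw [Measure.map_apply_of_aemeasurable hgm measurableSet_Iic,
    Measure.restrict_apply' measurableSet_Ioo, ← ofReal_cdf μ x]
  apply le_antisymm
  · calc volume (g ⁻¹' Set.Iic x ∩ Set.Ioo 0 1) ≤ volume (Set.Ioc 0 (cdf μ x)) := by
          refine measure_mono fun s hs => ⟨hs.2.1, ?_⟩
          have h := monotone_cdf μ (Set.mem_Iic.mp hs.1)
          rwa [hg s hs.2] at h
      _ = ENNReal.ofReal (cdf μ x) := by simp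
  · calc ENNReal.ofReal (cdf μ x) = volume (Set.Ioo 0 (cdf μ x)) := by simp
      _ ≤ volume (g ⁻¹' Set.Iic x ∩ Set.Ioo 0 1) := by
          refine measure_mono fun s hs => ?_
          have hs' : s ∈ Set.Ioo (0 : ℝ) 1 := ⟨hs.1, hs.2.trans_le (cdf_le_one μ x)⟩
          refine ⟨?_, hs'⟩
          by_contra h
          have h' := monotone_cdf μ (not_le.mp h).le
          rw [hg s hs'] at h'
          exact absurd hs.2 h'.not_gt

open ProbabilityTheory in
lemma integral_sq_gaussianReal_zero_one : ∫ x, x ^ 2 ∂gaussianReal 0 1 = 1 := by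
  have h := variance_fun_id_gaussianReal (μ := 0) (v := 1)
  rw [variance_eq_integral (by fun_prop)] at h
  simpa using h

/-- Squared 2-Wasserstein distance between one-dimensional Gaussians (Eq. 8 of the
paper): `∫₀¹ ((μ₁ + σ₁ g(s)) − (μ₂ + σ₂ g(s)))² ds = (μ₁ − μ₂)² + (σ₁ − σ₂)²`. -/
theorem wasserstein_gaussian_one_dim
    (Φ : ℝ → ℝ)
    (hΦ : ∀ x, Φ x = ProbabilityTheory.cdf (ProbabilityTheory.gaussianReal 0 1) x)
    (g : ℝ → ℝ) (hg : ∀ s ∈ Set.Ioo (0 : ℝ) 1, Φ (g s) = s)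
    (μ₁ μ₂ σ₁ σ₂ : ℝ) (hσ₁ : 0 ≤ σ₁) (hσ₂ : 0 ≤ σ₂) :
    IntegrableOn (fun s => ((μ₁ + σ₁ * g s) - (μ₂ + σ₂ * g s)) ^ 2) (Set.Ioo 0 1) ∧
      ∫ s in Set.Ioo (0 : ℝ) 1, ((μ₁ + σ₁ * g s) - (μ₂ + σ₂ * g s)) ^ 2
        = (μ₁ - μ₂) ^ 2 + (σ₁ - σ₂) ^ 2 := by
  have hmap := map_restrict_Ioo_of_cdf_rightInverse fun s hs => (hΦ (g s)).symm.trans (hg s hs)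
  have hgm : AEMeasurable g (volume.restrict (Set.Ioo (0 : ℝ) 1)) :=
    aemeasurable_restrict_of_monotoneOn measurableSet_Ioo
      (monotoneOn_of_cdf_rightInverse fun s hs => (hΦ (g s)).symm.trans (hg s hs))
  set γ := ProbabilityTheory.gaussianReal 0 1
  let f : ℝ → ℝ := fun x => ((μ₁ + σ₁ * x) - (μ₂ + σ₂ * x)) ^ 2
  have hf : f = fun x => ((μ₁ - μ₂) ^ 2 + 2 * (μ₁ - μ₂) * (σ₁ - σ₂) * x)
      + (σ₁ - σ₂) ^ 2 * x ^ 2 := by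
    funext x
    simp only [f]
    ring
  have hL : MemLp (fun x : ℝ => x) 2 γ := ProbabilityTheory.memLp_id_gaussianReal 2
  have h1 : Integrable (fun x : ℝ => 2 * (μ₁ - μ₂) * (σ₁ - σ₂) * x) γ :=
    (hL.integrable (by norm_num)).const_mul _
  have h01 : Integrable (fun x : ℝ => (μ₁ - μ₂) ^ 2 + 2 * (μ₁ - μ₂) * (σ₁ - σ₂) * x) γ :=
    (integrable_const _).add h1
  have h2 : Integrable (fun x : ℝ => (σ₁ - σ₂) ^ 2 * x ^ 2) γ := hL.integrable_sq.const_mul _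
  have hfi : Integrable f γ := hf ▸ h01.add h2
  have hfm : AEStronglyMeasurable f ((volume.restrict (Set.Ioo (0 : ℝ) 1)).map g) :=
    hmap ▸ hfi.aestronglyMeasurable
  refine ⟨(integrable_map_measure hfm hgm).mp (hmap ▸ hfi), ?_⟩
  calc ∫ s in Set.Ioo (0 : ℝ) 1, f (g s) = ∫ x, f x ∂γ := by
        rw [← integral_map hgm hfm, hmap]
    _ = (μ₁ - μ₂) ^ 2 + (σ₁ - σ₂) ^ 2 := by
        rw [hf, integral_add h01 h2, integral_add (integrable_const _) h1, integral_const_mul,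
          integral_const_mul, integral_sq_gaussianReal_zero_one,
          ProbabilityTheory.integral_id_gaussianReal]
        simp
end
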